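/- Let V satisfy Assumption (V) with exponent 0 < m ≤ 1 and let (φ^t) be the Hamiltonian flow of p(x,ξ) = V(x) + |ξ|²/2. For every T > 0 and every nonzero multi-index α ∈ ℕ^{2d}, there exists a constant C > 0 such that for every a ∈ S(1) and every t ∈ [−T, T], the composition a ∘ φ^t belongs to S(1) and ‖∂^α(a ∘ φ^t)‖_∞ ≤ C · max_{1 ≤ |β| ≤ |α|} ‖∂^β a‖_∞. -/

import Mathlib

noncomputable section

/-- The Japanese bracket `⟨x⟩ = (1 + |x|²)^{1/2}`. -/
def jap {E : Type*} [NormedAddCommGroup E] (x : E) : ℝ := Real.sqrt (1 + ‖x‖ ^ 2)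

/-- `φ` is the (globally defined) Hamiltonian flow of `p(x,ξ) = V(x) + |ξ|²/2`. -/
def IsFlowV (d : ℕ) (V : EuclideanSpace ℝ (Fin d) → ℝ)
    (φ : ℝ → EuclideanSpace ℝ (Fin d) × EuclideanSpace ℝ (Fin d) →
      EuclideanSpace ℝ (Fin d) × EuclideanSpace ℝ (Fin d)) : Prop :=
  (∀ ρ, φ 0 ρ = ρ) ∧ ∀ ρ t,
    HasDerivAt (fun s => (φ s ρ).1) ((φ t ρ).2) t ∧
    HasDerivAt (fun s => (φ s ρ).2) (-gradient V ((φ t ρ).1)) t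

/-- The symbol class `S(1)` on the phase space: smooth functions all of whose derivatives
are bounded. -/
def SOne (d : ℕ) (a : EuclideanSpace ℝ (Fin d) × EuclideanSpace ℝ (Fin d) → ℝ) : Prop :=
  ContDiff ℝ (⊤ : ℕ∞) a ∧ ∀ k : ℕ, ∃ B : ℝ, ∀ ρ, ‖iteratedFDeriv ℝ k a ρ‖ ≤ B

open Filter Topology

section BoundedDerivatives

variable {E F G : Type*} [NormedAddCommGroup E] [NormedSpace ℝ E]
  [NormedAddCommGroup F] [NormedSpace ℝ F] [NormedAddCommGroup G] [NormedSpace ℝ G]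

theorem iteratedFDeriv_sub_const {f : E → F} (hf : ContDiff ℝ (⊤ : ℕ∞) f) (c : F) {k : ℕ}
    (hk : k ≠ 0) : iteratedFDeriv ℝ k (f - fun _ => c) = iteratedFDeriv ℝ k f := by
  rw [iteratedFDeriv_sub (hf.of_le (by exact_mod_cast le_top)) contDiff_const,
    iteratedFDeriv_const_of_ne hk, sub_zero]

theorem norm_iteratedFDeriv_comp_le_of_pos {g : F → G} {f : E → F} (hg : ContDiff ℝ (⊤ : ℕ∞) g)
    (hf : ContDiff ℝ (⊤ : ℕ∞) f) {k : ℕ} (hk : k ≠ 0) (x : E) {C D : ℝ} (hC0 : 0 ≤ C)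
    (hC : ∀ i, 1 ≤ i → i ≤ k → ‖iteratedFDeriv ℝ i g (f x)‖ ≤ C)
    (hD : ∀ i, 1 ≤ i → i ≤ k → ‖iteratedFDeriv ℝ i f x‖ ≤ D ^ i) :
    ‖iteratedFDeriv ℝ k (fun y => g (f y)) x‖ ≤ k.factorial * C * D ^ k := by
  have h := norm_iteratedFDeriv_comp_le (g := g - fun _ => g (f x)) (f := f) (n := k)
    (hg.sub contDiff_const) hf (by exact_mod_cast le_top) x (C := C) (D := D) ?_ hD
  · have h2 : ((g - fun _ => g (f x)) ∘ f) = (fun y => g (f y)) - fun _ => g (f x) := rfl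
    rwa [h2, iteratedFDeriv_sub_const (f := fun y => g (f y)) (hg.comp hf) _ hk] at h
  · intro i hi
    rcases Nat.eq_zero_or_pos i with rfl | hpos
    · simpa using hC0
    · rw [iteratedFDeriv_sub_const hg _ hpos.ne']
      exact hC i hpos hi

theorem exists_norm_iteratedFDeriv_comp_le_mul_add {X : F → G} (hX : ContDiff ℝ (⊤ : ℕ∞) X)
    {c : ℕ → ℝ} (hc : ∀ k, 1 ≤ k → ∀ x, ‖iteratedFDeriv ℝ k X x‖ ≤ c k) (n : ℕ) (b : ℕ → ℝ) :
    ∃ B, 0 ≤ B ∧ ∀ g : E → F, ContDiff ℝ (⊤ : ℕ∞) g → ∀ x,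
      (∀ j, 1 ≤ j → j ≤ n → ‖iteratedFDeriv ℝ j g x‖ ≤ b j) →
      ‖iteratedFDeriv ℝ (n + 1) (fun y => X (g y)) x‖
        ≤ c 1 * ‖iteratedFDeriv ℝ (n + 1) g x‖ + B := by
  set A := ∑ i ∈ Finset.range (n + 1), |c (i + 1)| with hA
  set D := 1 + ∑ i ∈ Finset.range (n + 1), |b i| with hD
  have hA0 : 0 ≤ A := Finset.sum_nonneg fun _ _ => abs_nonneg _
  have hD1 : 1 ≤ D := le_add_of_nonneg_right (Finset.sum_nonneg fun _ _ => abs_nonneg _)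
  refine ⟨∑ i ∈ Finset.range n, (n.choose (i + 1) : ℝ) *
    ((i + 1).factorial * A * D ^ (i + 1)) * |b (n - i)|,
    Finset.sum_nonneg fun _ _ => by positivity, ?_⟩
  intro g hg x hgb
  have hdX : ContDiff ℝ (⊤ : ℕ∞) (fderiv ℝ X) := hX.fderiv_right (by simp)
  have hdg : ContDiff ℝ (⊤ : ℕ∞) (fderiv ℝ g) := hg.fderiv_right (by simp)
  have hfd : fderiv ℝ (fun y => X (g y)) =
      fun y => ContinuousLinearMap.compL ℝ E F G (fderiv ℝ X (g y)) (fderiv ℝ g y) := by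
    funext y
    exact fderiv_comp y (hX.differentiable (by simp) _) (hg.differentiable (by simp) _)
  rw [← norm_iteratedFDeriv_fderiv, hfd]
  have h := ContinuousLinearMap.norm_iteratedFDeriv_le_of_bilinear_of_le_one
    (ContinuousLinearMap.compL ℝ E F G) (hdX.comp hg) hdg x (n := n)
    (by exact_mod_cast le_top) (ContinuousLinearMap.norm_compL_le ℝ E F G)
  refine h.trans ?_
  rw [Finset.sum_range_succ', add_comm]
  refine add_le_add ?_ (Finset.sum_le_sum fun i hi => ?_)
  · simp only [Nat.choose_zero_right, Nat.cast_one, one_mul, norm_iteratedFDeriv_zero,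
      Function.comp_apply, Nat.sub_zero, norm_iteratedFDeriv_fderiv]
    gcongr
    rw [← norm_iteratedFDeriv_one]
    exact hc 1 le_rfl _
  · have hi' : i < n := Finset.mem_range.1 hi
    have e : n - (i + 1) + 1 = n - i := by omega
    rw [norm_iteratedFDeriv_fderiv, e]
    have h1 : ‖iteratedFDeriv ℝ (n - i) g x‖ ≤ |b (n - i)| :=
      (hgb _ (by omega) (by omega)).trans (le_abs_self _)
    have h2 : ‖iteratedFDeriv ℝ (i + 1) (fderiv ℝ X ∘ g) x‖
        ≤ (i + 1).factorial * A * D ^ (i + 1) := by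
      refine norm_iteratedFDeriv_comp_le hdX hg (by exact_mod_cast le_top) x ?_ ?_
      · intro j hj
        rw [norm_iteratedFDeriv_fderiv]
        refine (hc (j + 1) (by omega) _).trans ((le_abs_self _).trans ?_)
        exact Finset.single_le_sum (f := fun i => |c (i + 1)|) (fun _ _ => abs_nonneg _)
          (Finset.mem_range.2 (by omega))
      · intro j hj1 hj
        refine (hgb j hj1 (by omega)).trans ((le_abs_self _).trans ?_)
        have : |b j| ≤ D := (Finset.single_le_sum (f := fun i => |b i|) (s := Finset.range (n + 1))
          (fun _ _ => abs_nonneg _) (Finset.mem_range.2 (by omega))).trans (by simp [hD])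
        exact this.trans (le_self_pow₀ hD1 (by omega))
    gcongr

theorem norm_iteratedFDeriv_continuousLinearMap_le (L : E →L[ℝ] F) {k : ℕ} (hk : 1 ≤ k) (x : E) :
    ‖iteratedFDeriv ℝ k L x‖ ≤ ‖L‖ := by
  obtain ⟨n, rfl⟩ := Nat.exists_eq_add_of_le' hk
  have : fderiv ℝ L = fun _ => L := by funext y; exact L.fderiv
  rw [← norm_iteratedFDeriv_fderiv, this]
  rcases Nat.eq_zero_or_pos n with rfl | hn
  · simp
  · simp [iteratedFDeriv_const_of_ne hn.ne']

theorem norm_sub_le_of_norm_iteratedFDeriv_one_le {f : E → F} (hf : ContDiff ℝ (⊤ : ℕ∞) f) {L : ℝ}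
    (hL : ∀ x, ‖iteratedFDeriv ℝ 1 f x‖ ≤ L) (x y : E) : ‖f y - f x‖ ≤ L * ‖y - x‖ :=
  convex_univ.norm_image_sub_le_of_norm_fderiv_le (𝕜 := ℝ)
    (fun z _ => hf.differentiable (by simp) z)
    (fun z _ => by rw [← norm_iteratedFDeriv_one]; exact hL z) (Set.mem_univ _) (Set.mem_univ _)

end BoundedDerivatives

section Limits

/-- Uniform convergence on every ball centred at the origin. -/
def TendstoOnBalls {E F : Type*} [NormedAddCommGroup E] [NormedAddCommGroup F]
    (f : ℕ → E → F) (g : E → F) : Prop :=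
  ∀ R ε : ℝ, 0 < ε → ∃ N, ∀ n, N ≤ n → ∀ x, ‖x‖ ≤ R → ‖f n x - g x‖ ≤ ε

theorem TendstoOnBalls.tendsto {E F : Type*} [NormedAddCommGroup E] [NormedAddCommGroup F]
    {f : ℕ → E → F} {g : E → F} (h : TendstoOnBalls f g) (x : E) :
    Tendsto (fun n => f n x) atTop (𝓝 (g x)) := by
  rw [Metric.tendsto_atTop]
  intro ε hε
  obtain ⟨N, hN⟩ := h ‖x‖ (ε / 2) (half_pos hε)
  refine ⟨N, fun n hn => ?_⟩
  rw [dist_eq_norm]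
  linarith [hN n hn x le_rfl]

theorem TendstoOnBalls.tendstoLocallyUniformlyOn {E F : Type*} [NormedAddCommGroup E]
    [NormedAddCommGroup F] {f : ℕ → E → F} {g : E → F} (h : TendstoOnBalls f g) :
    TendstoLocallyUniformlyOn f g atTop Set.univ := by
  rw [Metric.tendstoLocallyUniformlyOn_iff]
  intro ε hε x _
  obtain ⟨N, hN⟩ := h (‖x‖ + 1) (ε / 2) (half_pos hε)
  refine ⟨Metric.ball x 1, mem_nhdsWithin_of_mem_nhds (Metric.ball_mem_nhds x one_pos), ?_⟩
  filter_upwards [eventually_ge_atTop N] with n hn y hy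
  rw [dist_comm, dist_eq_norm]
  have : ‖y‖ ≤ ‖x‖ + 1 := by
    have h1 : ‖y - x‖ < 1 := by simpa [dist_eq_norm] using hy
    linarith [norm_le_norm_add_norm_sub' y x]
  linarith [hN n hn y this]

/-- Interpolation: if the second derivatives are uniformly bounded, then convergence on balls
passes to the first derivatives. -/
theorem TendstoOnBalls.exists_fderiv {E F : Type*} [NormedAddCommGroup E] [NormedSpace ℝ E]
    [NormedAddCommGroup F] [NormedSpace ℝ F] [CompleteSpace F] {f : ℕ → E → F} {g : E → F}
    (h : TendstoOnBalls f g) (hf : ∀ n, ContDiff ℝ (⊤ : ℕ∞) (f n)) {C : ℝ}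
    (hC : ∀ n x, ‖iteratedFDeriv ℝ 2 (f n) x‖ ≤ C) :
    Differentiable ℝ g ∧ TendstoOnBalls (fun n => fderiv ℝ (f n)) (fderiv ℝ g) := by
  have hC0 : 0 ≤ C := (norm_nonneg _).trans (hC 0 0)
  have hlip : ∀ n x y, ‖fderiv ℝ (f n) y - fderiv ℝ (f n) x‖ ≤ C * ‖y - x‖ := fun n x y =>
    norm_sub_le_of_norm_iteratedFDeriv_one_le ((hf n).fderiv_right (by simp))
      (fun z => by rw [norm_iteratedFDeriv_fderiv]; exact hC n z) x y
  have htaylor : ∀ n x v, ‖f n (x + v) - f n x - fderiv ℝ (f n) x v‖ ≤ C * ‖v‖ * ‖v‖ := by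
    intro n x v
    have := (convex_closedBall x ‖v‖).norm_image_sub_le_of_norm_fderiv_le' (𝕜 := ℝ) (f := f n)
      (x := x) (y := x + v) (φ := fderiv ℝ (f n) x) (C := C * ‖v‖)
      (fun z _ => (hf n).differentiable (by simp) z)
      (fun z hz => (hlip n x z).trans (by
        gcongr; simpa [dist_eq_norm] using hz)) (by simp) (by simp)
    simpa using this
  have hcauchy : ∀ R ε : ℝ, 0 < ε → ∃ N, ∀ n, N ≤ n → ∀ m, N ≤ m → ∀ x, ‖x‖ ≤ R →
      ‖fderiv ℝ (f n) x - fderiv ℝ (f m) x‖ ≤ ε := by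
    intro R ε hε
    set s : ℝ := min 1 (ε / (4 * (C + 1))) with hs
    have hs0 : 0 < s := by positivity
    have hs1 : s ≤ 1 := min_le_left _ _
    have hsC : 2 * C * s ≤ ε / 2 := by
      have : s ≤ ε / (4 * (C + 1)) := min_le_right _ _
      rw [le_div_iff₀ (by positivity)] at this
      nlinarith
    obtain ⟨N, hN⟩ := h (R + 1) (ε * s / 8) (by positivity)
    refine ⟨N, fun n hn m hm x hx => ?_⟩
    refine ContinuousLinearMap.opNorm_le_of_unit_norm hε.le fun v hv => ?_
    have hsv : ‖s • v‖ = s := by rw [norm_smul, hv, mul_one, Real.norm_of_nonneg hs0.le]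
    have hxv : ‖x + s • v‖ ≤ R + 1 := (norm_add_le _ _).trans (by rw [hsv]; linarith)
    have hx' : ‖x‖ ≤ R + 1 := by linarith
    have t1 := htaylor n x (s • v)
    have t2 := htaylor m x (s • v)
    rw [hsv] at t1 t2
    have a1 := hN n hn _ hxv
    have a2 := hN m hm _ hxv
    have a3 := hN n hn _ hx'
    have a4 := hN m hm _ hx'
    have hle : s * ‖(fderiv ℝ (f n) x - fderiv ℝ (f m) x) v‖ ≤ s * ε := by
      have e : s • (fderiv ℝ (f n) x - fderiv ℝ (f m) x) v =
          -(f n (x + s • v) - f n x - fderiv ℝ (f n) x (s • v))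
          + (f m (x + s • v) - f m x - fderiv ℝ (f m) x (s • v))
          + (f n (x + s • v) - g (x + s • v)) - (f m (x + s • v) - g (x + s • v))
          - (f n x - g x) + (f m x - g x) := by
        simp only [map_smul, sub_apply, smul_sub]
        abel
      calc s * ‖(fderiv ℝ (f n) x - fderiv ℝ (f m) x) v‖
          = ‖s • (fderiv ℝ (f n) x - fderiv ℝ (f m) x) v‖ := by
            rw [norm_smul, Real.norm_of_nonneg hs0.le]
        _ ≤ C * s * s + C * s * s + ε * s / 8 + ε * s / 8 + ε * s / 8 + ε * s / 8 := by
            rw [e]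
            refine (norm_add_le _ _).trans (add_le_add ?_ a4)
            refine (norm_sub_le _ _).trans (add_le_add ?_ a3)
            refine (norm_sub_le _ _).trans (add_le_add ?_ a2)
            refine (norm_add_le _ _).trans (add_le_add ?_ a1)
            refine (norm_add_le _ _).trans (add_le_add ?_ t2)
            rwa [norm_neg]
        _ ≤ s * ε := by nlinarith
    exact le_of_mul_le_mul_left hle hs0
  have hlim : ∀ x, ∃ l, Tendsto (fun n => fderiv ℝ (f n) x) atTop (𝓝 l) := by
    intro x
    refine cauchySeq_tendsto_of_complete (Metric.cauchySeq_iff.2 fun ε hε => ?_)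
    obtain ⟨N, hN⟩ := hcauchy ‖x‖ (ε / 2) (half_pos hε)
    refine ⟨N, fun n hn m hm => ?_⟩
    rw [dist_eq_norm]
    linarith [hN n hn m hm x le_rfl]
  choose g' hg' using hlim
  have hballs : TendstoOnBalls (fun n => fderiv ℝ (f n)) g' := by
    intro R ε hε
    obtain ⟨N, hN⟩ := hcauchy R ε hε
    refine ⟨N, fun n hn x hx => ?_⟩
    refine le_of_tendsto ((tendsto_const_nhds.sub (hg' x)).norm) ?_
    filter_upwards [eventually_ge_atTop N] with m hm
    exact hN n hn m hm x hx
  have hderiv : ∀ x, HasFDerivAt g (g' x) x := fun x =>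
    hasFDerivAt_of_tendstoLocallyUniformlyOn isOpen_univ hballs.tendstoLocallyUniformlyOn
      (fun n y _ => ((hf n).differentiable (by simp) y).hasFDerivAt)
      (fun y _ => h.tendsto y) (Set.mem_univ x)
  have hfd : fderiv ℝ g = g' := funext fun x => (hderiv x).fderiv
  exact ⟨fun x => (hderiv x).differentiableAt, hfd ▸ hballs⟩

theorem TendstoOnBalls.contDiff_nat.{u} {E : Type u} [NormedAddCommGroup E] [NormedSpace ℝ E] (k : ℕ) :
    ∀ {F : Type u} [NormedAddCommGroup F] [NormedSpace ℝ F] [CompleteSpace F]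
    {f : ℕ → E → F} {g : E → F} (_ : TendstoOnBalls f g)
    (_ : ∀ n, ContDiff ℝ (⊤ : ℕ∞) (f n)) {C : ℕ → ℝ}
    (_ : ∀ n j, 1 ≤ j → ∀ x, ‖iteratedFDeriv ℝ j (f n) x‖ ≤ C j),
    ContDiff ℝ k g ∧ ∀ j, 1 ≤ j → j ≤ k → ∀ x, ‖iteratedFDeriv ℝ j g x‖ ≤ C j := by
  induction k with
  | zero =>
    intro F _ _ _ f g h hf C hC
    refine ⟨?_, fun j h1 h2 => by omega⟩
    exact contDiff_zero.2 (h.exists_fderiv hf fun n => hC n 2 (by norm_num)).1.continuous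
  | succ k ih =>
    intro F _ _ _ f g h hf C hC
    obtain ⟨hd, hb⟩ := h.exists_fderiv hf fun n => hC n 2 (by norm_num)
    obtain ⟨h1, h2⟩ := ih hb (fun n => (hf n).fderiv_right (by simp)) (C := fun j => C (j + 1))
      (fun n j _ x => by rw [norm_iteratedFDeriv_fderiv]; exact hC n (j + 1) (by omega) x)
    refine ⟨?_, fun j hj1 hjk x => ?_⟩
    · push_cast
      exact contDiff_succ_iff_fderiv.2 ⟨hd, by simp, h1⟩
    · obtain ⟨i, rfl⟩ := Nat.exists_eq_add_of_le' hj1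
      rcases Nat.eq_zero_or_pos i with rfl | hi
      · rw [zero_add, norm_iteratedFDeriv_one]
        refine le_of_tendsto ((hb.tendsto x).norm) (Eventually.of_forall fun n => ?_)
        rw [← norm_iteratedFDeriv_one]
        exact hC n 1 le_rfl x
      · rw [← norm_iteratedFDeriv_fderiv]
        exact h2 i hi (by omega) x

theorem TendstoOnBalls.contDiff.{u} {E F : Type u} [NormedAddCommGroup E] [NormedSpace ℝ E]
    [NormedAddCommGroup F] [NormedSpace ℝ F] [CompleteSpace F]
    {f : ℕ → E → F} {g : E → F} (h : TendstoOnBalls f g)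
    (hf : ∀ n, ContDiff ℝ (⊤ : ℕ∞) (f n)) {C : ℕ → ℝ}
    (hC : ∀ n j, 1 ≤ j → ∀ x, ‖iteratedFDeriv ℝ j (f n) x‖ ≤ C j) :
    ContDiff ℝ (⊤ : ℕ∞) g ∧ ∀ j, 1 ≤ j → ∀ x, ‖iteratedFDeriv ℝ j g x‖ ≤ C j :=
  ⟨contDiff_infty.2 fun k => (h.contDiff_nat k hf hC).1,
    fun j hj => (h.contDiff_nat j hf hC).2 j hj le_rfl⟩

end Limits

section Euler

theorem le_exp_mul_of_le_mul_add {u : ℕ → ℝ} {h L δ B : ℝ} (hh : 0 ≤ h) (hL : 1 ≤ L)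
    (hδ : 0 ≤ δ) (hB : 0 ≤ B) (h0 : u 0 ≤ δ)
    (hu : ∀ j, u (j + 1) ≤ (1 + h * L) * u j + h * B) (j : ℕ) :
    u j ≤ Real.exp (h * j * L) * (δ + B) := by
  have key : ∀ j, u j ≤ (1 + h * L) ^ j * (δ + B) - B := by
    intro j
    induction j with
    | zero => simpa using h0
    | succ j ih =>
      have h1 : (1 + h * L) * u j ≤ (1 + h * L) * ((1 + h * L) ^ j * (δ + B) - B) := by gcongr
      have h2 : h * B ≤ h * L * B := by nlinarith [mul_nonneg hh hB]
      rw [pow_succ]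
      linarith [hu j]
  have hexp : (1 + h * L) ^ j ≤ Real.exp (h * j * L) := by
    have : Real.exp (h * j * L) = Real.exp (h * L) ^ j := by
      rw [← Real.exp_nat_mul]; ring_nf
    rw [this]
    gcongr
    linarith [Real.add_one_le_exp (h * L)]
  calc u j ≤ (1 + h * L) ^ j * (δ + B) - B := key j
    _ ≤ (1 + h * L) ^ j * (δ + B) := by linarith
    _ ≤ _ := by gcongr

variable {E : Type*} [NormedAddCommGroup E] [NormedSpace ℝ E]

/-- One step of length `h` of the explicit Euler scheme for the vector field `X`. -/
def eulerStep (X : E → E) (h : ℝ) (x : E) : E := x + h • X x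

theorem contDiff_eulerStep_iterate {X : E → E} (hX : ContDiff ℝ (⊤ : ℕ∞) X) (h : ℝ) (j : ℕ) :
    ContDiff ℝ (⊤ : ℕ∞) ((eulerStep X h)^[j]) := by
  induction j with
  | zero => exact contDiff_id
  | succ j ih => exact ih.comp (contDiff_id.add (contDiff_const.smul hX))

theorem exists_norm_iteratedFDeriv_eulerStep_iterate_le {X : E → E}
    (hX : ContDiff ℝ (⊤ : ℕ∞) X) {c : ℕ → ℝ}
    (hc : ∀ k, 1 ≤ k → ∀ x, ‖iteratedFDeriv ℝ k X x‖ ≤ c k) {T : ℝ} :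
    ∃ b : ℕ → ℝ, ∀ k, 1 ≤ k → ∀ h, 0 ≤ h → ∀ j : ℕ, h * j ≤ T → ∀ x,
      ‖iteratedFDeriv ℝ k ((eulerStep X h)^[j]) x‖ ≤ b k := by
  suffices H : ∀ k, ∃ b : ℝ, 1 ≤ k → ∀ h, 0 ≤ h → ∀ j : ℕ, h * j ≤ T → ∀ x,
      ‖iteratedFDeriv ℝ k ((eulerStep X h)^[j]) x‖ ≤ b by
    choose b hb using H
    exact ⟨b, hb⟩
  intro k
  induction k using Nat.strong_induction_on with
  | _ k ih =>
  rcases Nat.eq_zero_or_pos k with rfl | hk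
  · exact ⟨0, fun h => by omega⟩
  obtain ⟨n, rfl⟩ := Nat.exists_eq_add_of_le' hk
  choose! b hb using ih
  obtain ⟨B, hB0, hB⟩ := exists_norm_iteratedFDeriv_comp_le_mul_add (E := E) hX hc n b
  set L := max 1 (c 1)
  refine ⟨Real.exp (T * L) * (1 + B), fun _ h hh j hj x => ?_⟩
  have hL : 1 ≤ L := le_max_left _ _
  set u : ℕ → ℝ := fun i => if i ≤ j then
    ‖iteratedFDeriv ℝ (n + 1) ((eulerStep X h)^[i]) x‖ else 0 with hu
  have hstep : ∀ i, u (i + 1) ≤ (1 + h * L) * u i + h * B := by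
    intro i
    by_cases hi : i + 1 ≤ j
    · simp only [hu, hi, if_true, (Nat.le_succ i).trans hi]
      have hgi := contDiff_eulerStep_iterate hX h i
      have hXg : ContDiff ℝ (⊤ : ℕ∞) (fun y => X ((eulerStep X h)^[i] y)) := hX.comp hgi
      have e : (eulerStep X h)^[i + 1] = (eulerStep X h)^[i] +
          h • (fun y => X ((eulerStep X h)^[i] y)) := by
        funext y
        rw [Function.iterate_succ_apply']
        rfl
      have hn : ((n + 1 : ℕ) : WithTop ℕ∞) ≤ ((⊤ : ℕ∞) : WithTop ℕ∞) := by
        exact_mod_cast le_top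
      rw [e, iteratedFDeriv_add_apply (hgi.of_le hn).contDiffAt
        (show ContDiffAt ℝ _ (h • _) x from (hXg.of_le hn).contDiffAt.const_smul h),
        iteratedFDeriv_const_smul_apply (hXg.of_le hn).contDiffAt]
      have h1 := hB _ hgi x fun l hl hln => hb l (by omega) hl h hh i
        (le_trans (by gcongr; omega) hj) x
      have h2 : ‖h • iteratedFDeriv ℝ (n + 1) (fun y => X ((eulerStep X h)^[i] y)) x‖ ≤
          h * (L * ‖iteratedFDeriv ℝ (n + 1) ((eulerStep X h)^[i]) x‖ + B) := by
        rw [norm_smul, Real.norm_of_nonneg hh]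
        gcongr
        exact h1.trans (by gcongr; exact le_max_right _ _)
      refine (norm_add_le _ _).trans ?_
      linarith
    · simp only [hu, hi, if_false]
      have : 0 ≤ u i := by simp only [hu]; split_ifs <;> positivity
      positivity
  have h0 : u 0 ≤ 1 := by
    simp only [hu, Nat.zero_le, if_true, Function.iterate_zero]
    exact (norm_iteratedFDeriv_continuousLinearMap_le (ContinuousLinearMap.id ℝ E)
      (Nat.le_add_left 1 n) x).trans ContinuousLinearMap.norm_id_le
  have := le_exp_mul_of_le_mul_add hh hL zero_le_one hB0 h0 hstep j
  simp only [hu, le_refl, if_true] at this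
  exact this.trans (by gcongr)

theorem norm_flow_le_gronwallBound {X : E → E} {L : ℝ} (hL0 : 0 ≤ L)
    (hL : ∀ x y, ‖X y - X x‖ ≤ L * ‖y - x‖) {γ : ℝ → E}
    (hγ : ∀ t, HasDerivAt γ (X (γ t)) t) {R T : ℝ} (hR : ‖γ 0‖ ≤ R) {t : ℝ}
    (ht : t ∈ Set.Icc 0 T) : ‖γ t‖ ≤ gronwallBound R L ‖X 0‖ T := by
  have h := norm_le_gronwallBound_of_norm_deriv_right_le (f := γ) (f' := fun t => X (γ t))
    (δ := R) (K := L) (ε := ‖X 0‖) (a := 0) (b := T)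
    (fun s _ => (hγ s).continuousAt.continuousWithinAt)
    (fun s _ => (hγ s).hasDerivWithinAt) hR
    (fun s _ => by
      have h1 := hL 0 (γ s)
      rw [sub_zero] at h1
      linarith [norm_le_norm_add_norm_sub' (X (γ s)) (X 0)]) t ht
  refine h.trans (gronwallBound_mono ((norm_nonneg _).trans hR) (norm_nonneg _) hL0 ?_)
  simpa using ht.2

theorem norm_flow_sub_eulerStep_iterate_le {X : E → E} {L : ℝ} (hL1 : 1 ≤ L)
    (hL : ∀ x y, ‖X y - X x‖ ≤ L * ‖y - x‖) {γ : ℝ → E}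
    (hγ : ∀ t, HasDerivAt γ (X (γ t)) t) {T M h : ℝ} (hh : 0 ≤ h)
    (hM0 : 0 ≤ M) (hM : ∀ s ∈ Set.Icc 0 T, ‖X (γ s)‖ ≤ M) {n : ℕ} (hn : h * n ≤ T) :
    ‖γ (h * n) - (eulerStep X h)^[n] (γ 0)‖ ≤ Real.exp (T * L) * (h * (L * M)) := by
  have hL0 : 0 ≤ L := by linarith
  set u : ℕ → ℝ := fun i => if i ≤ n then
    ‖γ (h * i) - (eulerStep X h)^[i] (γ 0)‖ else 0 with hu
  have hstep : ∀ i, u (i + 1) ≤ (1 + h * L) * u i + h * (h * (L * M)) := by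
    intro i
    by_cases hi : i + 1 ≤ n
    · simp only [hu, hi, if_true, (Nat.le_succ i).trans hi]
      set s := h * i with hs
      have hs' : h * ((i + 1 : ℕ) : ℝ) = s + h := by push_cast; ring
      have hs0 : 0 ≤ s := by positivity
      have hsT : s + h ≤ T := by
        rw [← hs']
        exact le_trans (by gcongr) hn
      have hmove : ∀ v ∈ Set.Icc s (s + h), ‖γ v - γ s‖ ≤ M * h := by
        intro v hv
        refine (norm_image_sub_le_of_norm_deriv_le_segment' (C := M)
          (fun w _ => (hγ w).hasDerivWithinAt)
          (fun w hw => hM w ⟨by linarith [hw.1], by linarith [hw.2]⟩) v hv).trans ?_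
        gcongr
        linarith [hv.2]
      have hloc : ‖γ (s + h) - γ s - h • X (γ s)‖ ≤ h * (h * (L * M)) := by
        have := norm_image_sub_le_of_norm_deriv_le_segment' (f := fun v => γ v - v • X (γ s))
          (a := s) (b := s + h) (f' := fun v => X (γ v) - (1 : ℝ) • X (γ s)) (C := L * (M * h))
          (fun w _ => ((hγ w).sub ((hasDerivAt_id w).smul_const _)).hasDerivWithinAt)
          (fun w hw => by
            rw [one_smul]
            exact (hL _ _).trans (by gcongr; exact hmove w ⟨hw.1, hw.2.le⟩))
          (s + h) ⟨by linarith, le_rfl⟩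
        have e : γ (s + h) - (s + h) • X (γ s) - (γ s - s • X (γ s)) =
            γ (s + h) - γ s - h • X (γ s) := by
          rw [add_smul]; abel
        rw [e] at this
        refine this.trans (le_of_eq (by ring))
      rw [hs', Function.iterate_succ_apply']
      set z := (eulerStep X h)^[i] (γ 0)
      have e : γ (s + h) - eulerStep X h z =
          (γ (s + h) - γ s - h • X (γ s)) + (γ s - z) + h • (X (γ s) - X z) := by
        simp only [eulerStep, smul_sub]; abel
      have h3 : ‖h • (X (γ s) - X z)‖ ≤ h * (L * ‖γ s - z‖) := by
        rw [norm_smul, Real.norm_of_nonneg hh]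
        gcongr
        exact hL _ _
      rw [e]
      refine (norm_add₃_le).trans ?_
      linarith
    · simp only [hu, hi, if_false]
      have : 0 ≤ u i := by simp only [hu]; split_ifs <;> positivity
      positivity
  have h0 : u 0 ≤ 0 := by simp [hu]
  have := le_exp_mul_of_le_mul_add hh hL1 le_rfl (by positivity) h0 hstep n
  simp only [hu, le_refl, if_true, zero_add] at this
  exact this.trans (by gcongr)

/-- The flow of a vector field whose derivatives of positive order are bounded is smooth, with
derivatives of positive order bounded uniformly on compact time intervals. -/
theorem exists_norm_iteratedFDeriv_flow_le [CompleteSpace E] {X : E → E}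
    (hX : ContDiff ℝ (⊤ : ℕ∞) X) {c : ℕ → ℝ}
    (hc : ∀ k, 1 ≤ k → ∀ x, ‖iteratedFDeriv ℝ k X x‖ ≤ c k) {φ : ℝ → E → E}
    (hφ0 : ∀ x, φ 0 x = x) (hφ : ∀ x t, HasDerivAt (fun s => φ s x) (X (φ t x)) t) (T : ℝ) :
    ∃ b : ℕ → ℝ, ∀ t ∈ Set.Icc 0 T, ContDiff ℝ (⊤ : ℕ∞) (φ t) ∧
      ∀ k, 1 ≤ k → ∀ x, ‖iteratedFDeriv ℝ k (φ t) x‖ ≤ b k := by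
  obtain ⟨b, hb⟩ := exists_norm_iteratedFDeriv_eulerStep_iterate_le hX hc (T := T)
  refine ⟨b, fun t ht => ?_⟩
  set L := max 1 (c 1) with hLdef
  have hL1 : 1 ≤ L := le_max_left _ _
  have hL0 : 0 ≤ L := by linarith
  have hL : ∀ x y, ‖X y - X x‖ ≤ L * ‖y - x‖ :=
    norm_sub_le_of_norm_iteratedFDeriv_one_le hX fun x => (hc 1 le_rfl x).trans (le_max_right _ _)
  have hstep : ∀ n : ℕ, t / (n + 1) * ((n + 1 : ℕ) : ℝ) = t := fun n => by
    push_cast; field_simp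
  have hstep0 : ∀ n : ℕ, 0 ≤ t / (n + 1) := fun n => div_nonneg ht.1 (by positivity)
  have hconv : TendstoOnBalls (fun n : ℕ => (eulerStep X (t / (n + 1)))^[n + 1]) (φ t) := by
    intro R ε hε
    set M := L * |gronwallBound R L ‖X 0‖ T| + ‖X 0‖ with hMdef
    have hM0 : 0 ≤ M := by positivity
    have hlim : Tendsto (fun n : ℕ => Real.exp (T * L) * (t / (n + 1) * (L * M))) atTop (𝓝 0) := by
      have h1 : Tendsto (fun n : ℕ => t / ((n : ℝ) + 1)) atTop (𝓝 0) :=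
        tendsto_const_div_atTop_nhds_zero_nat t |>.comp (tendsto_add_atTop_nat 1) |>.congr
          fun n => by simp
      simpa using (h1.mul_const (L * M)).const_mul (Real.exp (T * L))
    obtain ⟨N, hN⟩ := eventually_atTop.1 (hlim.eventually (eventually_le_nhds hε))
    refine ⟨N, fun n hn x hx => ?_⟩
    have hM : ∀ s ∈ Set.Icc 0 T, ‖X (φ s x)‖ ≤ M := by
      intro s hs
      have h1 := norm_flow_le_gronwallBound hL0 hL (hφ x) (R := R) (by rwa [hφ0]) hs
      have h2 := hL 0 (φ s x)
      rw [sub_zero] at h2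
      have h3 : L * ‖φ s x‖ ≤ L * |gronwallBound R L ‖X 0‖ T| := by
        gcongr
        exact h1.trans (le_abs_self _)
      linarith [norm_le_norm_add_norm_sub' (X (φ s x)) (X 0)]
    have h := norm_flow_sub_eulerStep_iterate_le hL1 hL (hφ x) (hstep0 n) hM0 hM (n := n + 1)
      (by rw [hstep]; exact ht.2)
    rw [hstep, hφ0] at h
    rw [norm_sub_rev]
    exact h.trans (hN n hn)
  exact hconv.contDiff (fun n => contDiff_eulerStep_iterate hX _ _) fun n j hj x =>
    hb j hj _ (hstep0 n) (n + 1) (by rw [hstep]; exact ht.2) x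

theorem exists_norm_iteratedFDeriv_flow_le_of_abs_le [CompleteSpace E] {X : E → E}
    (hX : ContDiff ℝ (⊤ : ℕ∞) X) {c : ℕ → ℝ}
    (hc : ∀ k, 1 ≤ k → ∀ x, ‖iteratedFDeriv ℝ k X x‖ ≤ c k) {φ : ℝ → E → E}
    (hφ0 : ∀ x, φ 0 x = x) (hφ : ∀ x t, HasDerivAt (fun s => φ s x) (X (φ t x)) t) (T : ℝ) :
    ∃ b : ℕ → ℝ, ∀ t ∈ Set.Icc (-T) T, ContDiff ℝ (⊤ : ℕ∞) (φ t) ∧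
      ∀ k, 1 ≤ k → ∀ x, ‖iteratedFDeriv ℝ k (φ t) x‖ ≤ b k := by
  obtain ⟨b₁, hb₁⟩ := exists_norm_iteratedFDeriv_flow_le hX hc hφ0 hφ T
  obtain ⟨b₂, hb₂⟩ := exists_norm_iteratedFDeriv_flow_le (X := -X) (φ := fun t => φ (-t)) hX.neg
    (c := c) (fun k hk x => by rw [iteratedFDeriv_neg_apply, norm_neg]; exact hc k hk x)
    (by simpa using hφ0)
    (fun x t => by
      simpa [Function.comp_def] using (hφ x (-t)).scomp t (hasDerivAt_neg t)) T
  refine ⟨fun k => max (b₁ k) (b₂ k), fun t ht => ?_⟩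
  rcases le_total 0 t with h | h
  · obtain ⟨h1, h2⟩ := hb₁ t ⟨h, ht.2⟩
    exact ⟨h1, fun k hk x => (h2 k hk x).trans (le_max_left _ _)⟩
  · obtain ⟨h1, h2⟩ := hb₂ (-t) ⟨by linarith, by linarith [ht.1]⟩
    simp only [neg_neg] at h1 h2
    exact ⟨h1, fun k hk x => (h2 k hk x).trans (le_max_right _ _)⟩

end Euler

section HamiltonianField

theorem one_le_jap {E : Type*} [NormedAddCommGroup E] (x : E) : 1 ≤ jap x :=
  Real.one_le_sqrt.2 (le_add_of_nonneg_right (sq_nonneg _))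

/-- The Hamiltonian vector field of `V(x) + |ξ|²/2`. -/
def hamField {E : Type*} [NormedAddCommGroup E] [InnerProductSpace ℝ E] [CompleteSpace E]
    (V : E → ℝ) (ρ : E × E) : E × E := (ρ.2, -gradient V ρ.1)

theorem contDiff_hamField {E : Type*} [NormedAddCommGroup E] [InnerProductSpace ℝ E]
    [CompleteSpace E] {V : E → ℝ} (hV : ContDiff ℝ (⊤ : ℕ∞) V) :
    ContDiff ℝ (⊤ : ℕ∞) (hamField V) := by
  have hg : ContDiff ℝ (⊤ : ℕ∞) (gradient V) :=
    (InnerProductSpace.toDual ℝ E).symm.contDiff.comp (hV.fderiv_right (by simp))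
  exact contDiff_snd.prodMk (hg.comp contDiff_fst).neg

theorem norm_iteratedFDeriv_hamField_le {E : Type*} [NormedAddCommGroup E]
    [InnerProductSpace ℝ E] [CompleteSpace E] {V : E → ℝ} (hV : ContDiff ℝ (⊤ : ℕ∞) V)
    {k : ℕ} (hk : 1 ≤ k) {C : ℝ} (hC : ∀ x, ‖iteratedFDeriv ℝ (k + 1) V x‖ ≤ C) (ρ : E × E) :
    ‖iteratedFDeriv ℝ k (hamField V) ρ‖ ≤
      ‖(ContinuousLinearMap.inl ℝ E E).comp (ContinuousLinearMap.snd ℝ E E)‖ +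
      ‖-(ContinuousLinearMap.inr ℝ E E)‖ * (C * ‖ContinuousLinearMap.fst ℝ E E‖ ^ k) := by
  have hg : ContDiff ℝ (⊤ : ℕ∞) (gradient V) :=
    (InnerProductSpace.toDual ℝ E).symm.contDiff.comp (hV.fderiv_right (by simp))
  have hgf : ContDiff ℝ (⊤ : ℕ∞) (gradient V ∘ ContinuousLinearMap.fst ℝ E E) :=
    hg.comp contDiff_fst
  have hn : ((k : ℕ) : WithTop ℕ∞) ≤ ((⊤ : ℕ∞) : WithTop ℕ∞) := by exact_mod_cast le_top
  have e : hamField V =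
      ⇑((ContinuousLinearMap.inl ℝ E E).comp (ContinuousLinearMap.snd ℝ E E)) +
      ⇑(-(ContinuousLinearMap.inr ℝ E E)) ∘ (gradient V ∘ ContinuousLinearMap.fst ℝ E E) := by
    funext ρ
    simp [hamField]
  rw [e, iteratedFDeriv_add_apply (ContinuousLinearMap.contDiff _).contDiffAt
    (((ContinuousLinearMap.contDiff _).comp hgf).of_le hn).contDiffAt]
  refine (norm_add_le _ _).trans (add_le_add
    (norm_iteratedFDeriv_continuousLinearMap_le _ hk ρ) ?_)
  refine (ContinuousLinearMap.norm_iteratedFDeriv_comp_left _ hgf.contDiffAt hn).trans ?_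
  gcongr
  rw [ContinuousLinearMap.iteratedFDeriv_comp_right _ hg ρ hn]
  refine (ContinuousMultilinearMap.norm_compContinuousLinearMap_le _ _).trans ?_
  rw [Finset.prod_const, Finset.card_univ, Fintype.card_fin]
  gcongr
  have e2 : gradient V = (InnerProductSpace.toDual ℝ E).symm ∘ fderiv ℝ V := rfl
  have h := (InnerProductSpace.toDual ℝ E).symm.norm_iteratedFDeriv_comp_left (fderiv ℝ V) ρ.1 k
  rw [norm_iteratedFDeriv_fderiv] at h
  exact (le_of_eq h).trans (hC _)

end HamiltonianField

/-- Continuity of composition by the Hamiltonian flow in `S(1)`: for every `T > 0` and every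
derivative order `k ≥ 1` there is `C > 0` such that for all `a ∈ S(1)` and `t ∈ [-T,T]`,
`a ∘ φᵗ ∈ S(1)` and `‖D^k (a ∘ φᵗ)‖_∞ ≤ C · max_{1 ≤ j ≤ k} ‖D^j a‖_∞`. -/
theorem stmt_5 (d : ℕ) (m : ℝ) (hm : 0 < m) (hm' : m ≤ 1)
    (V : EuclideanSpace ℝ (Fin d) → ℝ) (hVsmooth : ContDiff ℝ (⊤ : ℕ∞) V)
    (hVell : ∃ C : ℝ, 1 ≤ C ∧ ∃ r₀ > 0, ∀ x, r₀ ≤ ‖x‖ →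
      C⁻¹ * jap x ^ (2 * m) ≤ V x ∧ V x ≤ C * jap x ^ (2 * m))
    (hVder : ∀ k : ℕ, ∃ Ck > 0, ∀ x,
      ‖iteratedFDeriv ℝ k V x‖ ≤ Ck * jap x ^ (2 * m - k))
    (φ : ℝ → EuclideanSpace ℝ (Fin d) × EuclideanSpace ℝ (Fin d) →
      EuclideanSpace ℝ (Fin d) × EuclideanSpace ℝ (Fin d))
    (hφ : IsFlowV d V φ)
    (T : ℝ) (hT : 0 < T) (k : ℕ) (hk : k ≠ 0) :
    ∃ C > 0, ∀ a : EuclideanSpace ℝ (Fin d) × EuclideanSpace ℝ (Fin d) → ℝ,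
      SOne d a → ∀ t ∈ Set.Icc (-T) T,
        SOne d (fun ρ => a (φ t ρ)) ∧
        ∀ M : ℝ, (∀ j : ℕ, 1 ≤ j → j ≤ k → ∀ ρ, ‖iteratedFDeriv ℝ j a ρ‖ ≤ M) →
          ∀ ρ, ‖iteratedFDeriv ℝ k (fun ρ' => a (φ t ρ')) ρ‖ ≤ C * M := by
  have hVbd : ∀ k : ℕ, ∃ C : ℝ, 1 ≤ k → ∀ x, ‖iteratedFDeriv ℝ (k + 1) V x‖ ≤ C := by
    intro k
    obtain ⟨C, hC0, hC⟩ := hVder (k + 1)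
    refine ⟨C, fun hk x => (hC x).trans (mul_le_of_le_one_right hC0.le ?_)⟩
    refine Real.rpow_le_one_of_one_le_of_nonpos (one_le_jap x) ?_
    have : (1 : ℝ) ≤ k := by exact_mod_cast hk
    push_cast
    linarith
  choose C hC using hVbd
  obtain ⟨b, hb⟩ := exists_norm_iteratedFDeriv_flow_le_of_abs_le (contDiff_hamField hVsmooth)
    (fun k hk ρ => norm_iteratedFDeriv_hamField_le hVsmooth hk (hC k hk) ρ) hφ.1
    (fun ρ t => (hφ.2 ρ t).1.prodMk (hφ.2 ρ t).2) T
  set D : ℕ → ℝ := fun n => 1 + ∑ i ∈ Finset.range (n + 1), |b i| with hD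
  have hD1 : ∀ n, 1 ≤ D n := fun n =>
    le_add_of_nonneg_right (Finset.sum_nonneg fun _ _ => abs_nonneg _)
  have hbD : ∀ n, ∀ t ∈ Set.Icc (-T) T, ∀ ρ i, 1 ≤ i → i ≤ n →
      ‖iteratedFDeriv ℝ i (φ t) ρ‖ ≤ D n ^ i := by
    intro n t ht ρ i hi hin
    refine ((hb t ht).2 i hi ρ).trans ((le_abs_self _).trans ?_)
    have : |b i| ≤ D n := (Finset.single_le_sum (f := fun i => |b i|) (s := Finset.range (n + 1))
      (fun _ _ => abs_nonneg _) (Finset.mem_range.2 (by omega))).trans (by simp [hD])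
    exact this.trans (le_self_pow₀ (hD1 n) (by omega))
  have hD0 := hD1 k
  refine ⟨k.factorial * D k ^ k, by positivity, fun a ha t ht => ⟨⟨ha.1.comp (hb t ht).1, ?_⟩, ?_⟩⟩
  · intro n
    choose A hA using ha.2
    refine ⟨n.factorial * (∑ i ∈ Finset.range (n + 1), |A i|) * D n ^ n, fun ρ => ?_⟩
    refine norm_iteratedFDeriv_comp_le ha.1 (hb t ht).1 (by exact_mod_cast le_top) ρ
      (fun i hi => (hA i _).trans ((le_abs_self _).trans ?_)) (hbD n t ht ρ)
    exact Finset.single_le_sum (f := fun i => |A i|) (fun _ _ => abs_nonneg _)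
      (Finset.mem_range.2 (by omega))
  · intro M hM ρ
    have hM0 : 0 ≤ M := (norm_nonneg _).trans (hM 1 le_rfl (Nat.one_le_iff_ne_zero.2 hk) 0)
    refine (norm_iteratedFDeriv_comp_le_of_pos ha.1 (hb t ht).1 hk ρ hM0
      (fun i hi hik => hM i hi hik _) (hbD k t ht ρ)).trans (le_of_eq (by ring))

end
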